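/- arXiv:2102.10872 — 2 statements merged into one kernel-verified Lean document; each statement's English description precedes it below -/
import Mathlib

section
/- Let S be any semigroup and let ℕ denote the semigroup of positive integers under addition. Then the direct product ℕ × S is weakly subsemigroup separable but not strongly subsemigroup separable if and only if S is residually finite but not completely separable. -/
/-- `s` can be separated from `Y` in `S`: there is a homomorphism to a finite
semigroup mapping `s` outside the image of `Y`. -/
def Separates {S : Type*} [Semigroup S] (s : S) (Y : Set S) : Prop :=
  ∃ (P : Type) (_ : Semigroup P) (_ : Finite P) (φ : S →ₙ* P), φ s ∉ φ '' Y

/-- Complete separability. -/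
def IsCS (S : Type*) [Semigroup S] : Prop :=
  ∀ (s : S) (Y : Set S), s ∉ Y → Separates s Y

/-- Strong subsemigroup separability. -/
def IsSSS (S : Type*) [Semigroup S] : Prop :=
  ∀ (s : S) (Y : Subsemigroup S), s ∉ Y → Separates s (Y : Set S)

/-- Weak subsemigroup separability. -/
def IsWSS (S : Type*) [Semigroup S] : Prop :=
  ∀ (s : S) (X : Finset S), s ∉ Subsemigroup.closure (X : Set S) →
    Separates s (Subsemigroup.closure (X : Set S) : Set S)

/-- Monogenic subsemigroup separability. -/
def IsMSS (S : Type*) [Semigroup S] : Prop :=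
  ∀ (s x : S), s ∉ Subsemigroup.closure {x} →
    Separates s (Subsemigroup.closure {x} : Set S)

/-- Residual finiteness. -/
def ResiduallyFinite (S : Type*) [Semigroup S] : Prop :=
  ∀ s t : S, s ≠ t → ∃ (P : Type) (_ : Semigroup P) (_ : Finite P) (φ : S →ₙ* P), φ s ≠ φ t

/-- The largest congruence contained in the kernel of a map `g`. -/
def syntacticCon {S X : Type*} [Semigroup S] (g : S → X) : Con S where
  r a b := g a = g b ∧ (∀ x, g (x * a) = g (x * b)) ∧ (∀ y, g (a * y) = g (b * y)) ∧
    ∀ x y, g (x * a * y) = g (x * b * y)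
  iseqv :=
    { refl := fun _ => ⟨rfl, fun _ => rfl, fun _ => rfl, fun _ _ => rfl⟩
      symm := fun ⟨h₁, h₂, h₃, h₄⟩ =>
        ⟨h₁.symm, fun x => (h₂ x).symm, fun y => (h₃ y).symm, fun x y => (h₄ x y).symm⟩
      trans := fun ⟨h₁, h₂, h₃, h₄⟩ ⟨k₁, k₂, k₃, k₄⟩ =>
        ⟨h₁.trans k₁, fun x => (h₂ x).trans (k₂ x), fun y => (h₃ y).trans (k₃ y),
          fun x y => (h₄ x y).trans (k₄ x y)⟩ }
  mul' := by
    rintro a b c d ⟨-, -, h₃, h₄⟩ ⟨-, k₂, -, k₄⟩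
    refine ⟨(h₃ c).trans (k₂ b), fun x => ?_, fun y => ?_, fun x y => ?_⟩
    · rw [← mul_assoc, ← mul_assoc, h₄ x c, k₂]
    · rw [mul_assoc, h₃, ← mul_assoc, k₄]
    · rw [← mul_assoc x a c, mul_assoc (x * a) c y, h₄, ← mul_assoc, k₄, mul_assoc x b d]

/-- A congruence of finite index is the kernel of a homomorphism to a finite semigroup. -/
theorem Con.exists_hom_finite {S X : Type*} [Semigroup S] [Finite X] (c : Con S) (f : S → X)
    (hf : ∀ a b, f a = f b → c a b) :
    ∃ (P : Type) (_ : Semigroup P) (_ : Finite P) (φ : S →ₙ* P), ∀ a b, φ a = φ b → c a b := by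
  have : Finite c.Quotient := by
    refine Finite.of_injective (fun q : c.Quotient => f q.out) fun p q h => ?_
    rw [← Quotient.out_eq p, ← Quotient.out_eq q]
    exact Quotient.sound (hf _ _ h)
  obtain ⟨P, ⟨e⟩⟩ : ∃ P : Type, Nonempty (c.Quotient ≃ P) :=
    ⟨_, (Finite.exists_equiv_fin c.Quotient).choose_spec⟩
  let : Semigroup P := e.symm.semigroup
  refine ⟨P, inferInstance, Finite.of_equiv _ e,
    ⟨fun a => e (a : c.Quotient), fun a b => ?_⟩, fun a b h => ?_⟩
  · simp [Equiv.mul_def]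
  · exact c.eq.1 (e.injective h)

theorem Separates.union {S : Type*} [Semigroup S] {s : S} {A B : Set S}
    (hA : Separates s A) (hB : Separates s B) : Separates s (A ∪ B) := by
  obtain ⟨P, _, _, φ, hφ⟩ := hA
  obtain ⟨Q, _, _, ψ, hψ⟩ := hB
  refine ⟨P × Q, inferInstance, inferInstance, φ.prod ψ, ?_⟩
  rintro ⟨t, ht, h⟩
  obtain ⟨h₁, h₂⟩ := Prod.ext_iff.1 h
  exact ht.elim (fun ht => hφ ⟨t, ht, h₁⟩) fun ht => hψ ⟨t, ht, h₂⟩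

theorem ResiduallyFinite.separates_finite {S : Type*} [Semigroup S] (hS : ResiduallyFinite S)
    {s : S} {A : Set S} (hA : A.Finite) (hs : s ∉ A) : Separates s A := by
  induction A, hA using Set.Finite.induction_on with
  | empty => exact ⟨Unit, inferInstance, inferInstance, ⟨fun _ => (), fun _ _ => rfl⟩, by simp⟩
  | @insert a A _ _ ih =>
    rw [Set.mem_insert_iff, not_or] at hs
    obtain ⟨P, i, j, φ, hφ⟩ := hS s a hs.1
    rw [Set.insert_eq]
    exact Separates.union ⟨P, i, j, φ, by simpa [eq_comm] using hφ⟩ (ih hs.2)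

/-- The additive semigroup of positive integers is completely separable. -/
theorem isCS_multiplicative_pnat : IsCS (Multiplicative ℕ+) := by
  intro n Y hn
  let val : Multiplicative ℕ+ → ℕ := fun k => (k.toAdd : ℕ)
  have val_mul (a b) : val (a * b) = val a + val b := rfl
  let f : Multiplicative ℕ+ → Set.Iic (val n + 1) := fun k =>
    ⟨min (val k) (val n + 1), Set.mem_Iic.2 (min_le_right _ _)⟩
  have hf {a b} : f a = f b ↔ min (val a) (val n + 1) = min (val b) (val n + 1) :=
    Subtype.ext_iff
  let c : Con (Multiplicative ℕ+) :=
    { Setoid.ker f with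
      mul' := by
        intro w x y z h k
        have h := hf.1 h
        have k := hf.1 k
        refine hf.2 ?_
        rw [val_mul, val_mul]
        omega }
  obtain ⟨P, i, j, φ, hφ⟩ := c.exists_hom_finite f fun _ _ h => h
  refine ⟨P, i, j, φ, ?_⟩
  rintro ⟨t, ht, h⟩
  have h := hf.1 (hφ _ _ h)
  have hv : val t = val n := by omega
  have : t = n := PNat.eq hv
  exact hn (this ▸ ht)

/-- A product element is separated from a set as soon as its second coordinate is separated
from the fibre over its first coordinate. -/
theorem Separates.pnat_prod {S : Type*} [Semigroup S] {n : Multiplicative ℕ+} {s : S}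
    {Y : Set (Multiplicative ℕ+ × S)} (h : Separates s {t | (n, t) ∈ Y}) :
    Separates (n, s) Y := by
  obtain ⟨P, _, _, φ, hφ⟩ := h
  obtain ⟨Q, _, _, ψ, hψ⟩ := isCS_multiplicative_pnat n {n}ᶜ (by simp)
  refine ⟨Q × P, inferInstance, inferInstance, ψ.prodMap φ, ?_⟩
  rintro ⟨⟨m, t⟩, ht, h⟩
  obtain ⟨h₁, h₂⟩ := Prod.ext_iff.1 h
  by_cases hm : m = n
  · subst hm
    exact hφ ⟨t, ht, h₂⟩
  · exact hψ ⟨m, hm, h₁⟩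

/-- A finitely generated subsemigroup of `ℕ × S` has only finitely many elements with bounded
first coordinate. -/
theorem finite_closure_fst_le {S : Type*} [Semigroup S] (X : Finset (Multiplicative ℕ+ × S))
    (n : ℕ) : {p | p ∈ Subsemigroup.closure (X : Set (Multiplicative ℕ+ × S)) ∧
      (p.1.toAdd : ℕ) ≤ n}.Finite := by
  induction n with
  | zero =>
    convert Set.finite_empty
    ext p
    simp
  | succ n ih =>
    refine (X.finite_toSet.union (Set.Finite.image2 (· * ·) ih ih)).subset ?_
    rintro p ⟨hp, hn⟩
    have key : p ∈ X ∨ ∃ q ∈ Subsemigroup.closure (X : Set (Multiplicative ℕ+ × S)),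
        ∃ r ∈ Subsemigroup.closure (X : Set (Multiplicative ℕ+ × S)), q * r = p := by
      induction hp using Subsemigroup.closure_induction with
      | mem x hx => exact Or.inl hx
      | mul x y hx hy => exact Or.inr ⟨x, hx, y, hy, rfl⟩
    rcases key with h | ⟨q, hq, r, hr, rfl⟩
    · exact Or.inl h
    · have h : (q.1.toAdd : ℕ) + (r.1.toAdd : ℕ) ≤ n + 1 := hn
      have hq0 := q.1.toAdd.pos
      have hr0 := r.1.toAdd.pos
      exact Or.inr ⟨q, ⟨hq, by omega⟩, r, ⟨hr, by omega⟩, rfl⟩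

/-- Every finite image of `ℕ × S` yields a finite image of `S` that sees the fibre over `3`:
the values over `1`, `2` and `3` determine all two-sided translates over `3`. -/
theorem exists_hom_of_pnat_prod {S P : Type*} [Semigroup S] [Semigroup P] [Finite P]
    (φ : Multiplicative ℕ+ × S →ₙ* P) :
    ∃ (Q : Type) (_ : Semigroup Q) (_ : Finite Q) (ψ : S →ₙ* Q), ∀ a b, ψ a = ψ b →
      φ (.ofAdd 3, a) = φ (.ofAdd 3, b) := by
  obtain ⟨Q, i, j, ψ, hψ⟩ := (syntacticCon fun a => φ (.ofAdd 3, a)).exists_hom_finite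
    (fun a => (φ (.ofAdd 1, a), φ (.ofAdd 2, a), φ (.ofAdd 3, a))) (by
      intro a b h
      simp only [Prod.mk.injEq] at h
      obtain ⟨h₁, h₂, h₃⟩ := h
      have left (x a : S) : φ (.ofAdd 3, x * a) = φ (.ofAdd 1, x) * φ (.ofAdd 2, a) := by
        rw [← map_mul]; rfl
      have right (a y : S) : φ (.ofAdd 3, a * y) = φ (.ofAdd 2, a) * φ (.ofAdd 1, y) := by
        rw [← map_mul]; rfl
      have mid (x a : S) : φ (.ofAdd 2, x * a) = φ (.ofAdd 1, x) * φ (.ofAdd 1, a) := by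
        rw [← map_mul]; rfl
      refine ⟨h₃, fun x => ?_, fun y => ?_, fun x y => ?_⟩
      · simp only [left, h₂]
      · simp only [right, h₂]
      · simp only [right, mid, h₁])
  exact ⟨Q, i, j, ψ, fun a b h => (hψ a b h).1⟩

theorem isWSS_pnat_prod_iff (S : Type*) [Semigroup S] :
    IsWSS (Multiplicative ℕ+ × S) ↔ ResiduallyFinite S := by
  constructor
  · intro h s t hst
    have hs : ((.ofAdd 3, s) : Multiplicative ℕ+ × S) ∉ Subsemigroup.closure
        (({(.ofAdd 3, t)} : Finset (Multiplicative ℕ+ × S)) :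
          Set (Multiplicative ℕ+ × S)) := by
      intro hmem
      have key : ∀ p ∈ Subsemigroup.closure
          (({(.ofAdd 3, t)} : Finset (Multiplicative ℕ+ × S)) :
          Set (Multiplicative ℕ+ × S)),
          p = (.ofAdd 3, t) ∨ 3 < (p.1.toAdd : ℕ) := by
        intro p hp
        induction hp using Subsemigroup.closure_induction with
        | mem x hx => exact Or.inl (by simpa using hx)
        | mul x y _ _ hx hy =>
          have ge (z : Multiplicative ℕ+ × S)
              (hz : z = (.ofAdd 3, t) ∨ 3 < (z.1.toAdd : ℕ)) : 3 ≤ (z.1.toAdd : ℕ) := by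
            rcases hz with rfl | hz
            · exact le_refl 3
            · exact hz.le
          have hx := ge x hx
          have hy := ge y hy
          have : ((x * y).1.toAdd : ℕ) = x.1.toAdd + y.1.toAdd := rfl
          omega
      rcases key _ hmem with h | h
      · exact hst (Prod.ext_iff.1 h).2
      · exact absurd h (lt_irrefl 3)
    obtain ⟨P, _, _, φ, hφ⟩ := h _ _ hs
    obtain ⟨Q, i, j, ψ, hψ⟩ := exists_hom_of_pnat_prod φ
    exact ⟨Q, i, j, ψ, fun h =>
      hφ ⟨(.ofAdd 3, t), Subsemigroup.subset_closure (by simp), (hψ _ _ h).symm⟩⟩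
  · rintro h ⟨n, s⟩ X hs
    refine Separates.pnat_prod (h.separates_finite ?_ hs)
    refine ((finite_closure_fst_le X n.toAdd).image Prod.snd).subset fun t ht => ?_
    exact ⟨(n, t), ⟨ht, le_rfl⟩, rfl⟩

theorem isSSS_pnat_prod_iff (S : Type*) [Semigroup S] :
    IsSSS (Multiplicative ℕ+ × S) ↔ IsCS S := by
  constructor
  · intro h s Y hs
    let T : Subsemigroup (Multiplicative ℕ+ × S) :=
      { carrier := {p | 3 ≤ (p.1.toAdd : ℕ) ∧ ((p.1.toAdd : ℕ) = 3 → p.2 ∈ Y)}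
        mul_mem' := by
          rintro a b ⟨ha, -⟩ ⟨hb, -⟩
          have : ((a * b).1.toAdd : ℕ) = a.1.toAdd + b.1.toAdd := rfl
          exact ⟨by omega, fun h => by omega⟩ }
    obtain ⟨P, _, _, φ, hφ⟩ := h (.ofAdd 3, s) T fun hT => hs (hT.2 rfl)
    obtain ⟨Q, i, j, ψ, hψ⟩ := exists_hom_of_pnat_prod φ
    refine ⟨Q, i, j, ψ, ?_⟩
    rintro ⟨t, ht, h⟩
    exact hφ ⟨(.ofAdd 3, t), ⟨le_refl 3, fun _ => ht⟩, hψ _ _ h⟩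
  · rintro h ⟨n, s⟩ Y hs
    exact Separates.pnat_prod (h s _ hs)

/-- `ℕ × S` is weakly subsemigroup separable but not strongly subsemigroup separable
iff `S` is residually finite but not completely separable. -/
theorem stmt_1 (S : Type*) [Semigroup S] :
    (IsWSS (Multiplicative ℕ+ × S) ∧ ¬ IsSSS (Multiplicative ℕ+ × S)) ↔
      (ResiduallyFinite S ∧ ¬ IsCS S) := by
  rw [isWSS_pnat_prod_iff, isSSS_pnat_prod_iff]
end

section
/- If S and T are weakly subsemigroup separable semigroups, then the direct product S × T is monogenic subsemigroup separable. -/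
section SemigroupPowers

variable {S T : Type*} [Semigroup S] [Semigroup T]

/-- The power `x ^ (n + 1)` in a semigroup. -/
def succPow (x : S) : ℕ → S
  | 0 => x
  | n + 1 => succPow x n * x

theorem succPow_mul_succPow (x : S) (m n : ℕ) :
    succPow x m * succPow x n = succPow x (m + n + 1) := by
  induction n with
  | zero => rfl
  | succ n ih =>
    change succPow x m * (succPow x n * x) = succPow x (m + n + 1) * x
    rw [← mul_assoc, ih]

theorem succPow_succPow (x : S) (m n : ℕ) :
    succPow (succPow x m) n = succPow x ((m + 1) * n + m) := by
  induction n with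
  | zero => simp [succPow]
  | succ n ih =>
    change succPow (succPow x m) n * succPow x m = _
    rw [ih, succPow_mul_succPow]
    congr 1
    ring

theorem map_succPow (φ : S →ₙ* T) (x : S) (n : ℕ) :
    φ (succPow x n) = succPow (φ x) n := by
  induction n with
  | zero => rfl
  | succ n ih => rw [succPow, map_mul, ih, succPow]

theorem succPow_prod (x : S) (y : T) (n : ℕ) :
    succPow (x, y) n = (succPow x n, succPow y n) :=
  Prod.ext (map_succPow (MulHom.fst S T) (x, y) n) (map_succPow (MulHom.snd S T) (x, y) n)

theorem succPow_add_eq_of_eq {x : S} {m n : ℕ} (h : succPow x m = succPow x n) (k : ℕ) :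
    succPow x (m + k) = succPow x (n + k) := by
  cases k with
  | zero => exact h
  | succ k =>
    rw [← add_assoc, ← add_assoc, ← succPow_mul_succPow, h, succPow_mul_succPow]

theorem mem_closure_singleton_iff_exists_succPow {s x : S} :
    s ∈ Subsemigroup.closure {x} ↔ ∃ n, succPow x n = s := by
  constructor
  · intro h
    induction h using Subsemigroup.closure_induction with
    | mem y hy => exact ⟨0, (Set.mem_singleton_iff.mp hy).symm⟩
    | mul y z _ _ hy hz =>
      obtain ⟨m, rfl⟩ := hy
      obtain ⟨n, rfl⟩ := hz
      exact ⟨m + n + 1, (succPow_mul_succPow x m n).symm⟩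
  · rintro ⟨n, rfl⟩
    have hx : x ∈ Subsemigroup.closure {x} := Subsemigroup.subset_closure rfl
    induction n with
    | zero => exact hx
    | succ n ih => exact mul_mem ih hx

theorem mem_closure_succPow_Icc_iff {s x : S} {m : ℕ} :
    s ∈ Subsemigroup.closure (succPow x '' Set.Icc (m + 1) (2 * m + 2)) ↔
      ∃ n, m < n ∧ succPow x n = s := by
  constructor
  · intro h
    induction h using Subsemigroup.closure_induction with
    | mem y hy =>
      obtain ⟨n, hn, rfl⟩ := hy
      exact ⟨n, hn.1, rfl⟩
    | mul y z _ _ hy hz =>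
      obtain ⟨k, hk, rfl⟩ := hy
      obtain ⟨n, hn, rfl⟩ := hz
      exact ⟨k + n + 1, by lia, (succPow_mul_succPow x k n).symm⟩
  · rintro ⟨n, hn, rfl⟩
    induction n using Nat.strong_induction_on with
    | _ n ih =>
      by_cases h : n ≤ 2 * m + 2
      · exact Subsemigroup.subset_closure ⟨n, ⟨hn, h⟩, rfl⟩
      · have key : succPow x (n - (m + 2)) * succPow x (m + 1) = succPow x n := by
          rw [succPow_mul_succPow]
          congr 1
          lia
        rw [← key]
        exact mul_mem (ih _ (by lia) (by lia))
          (Subsemigroup.subset_closure ⟨m + 1, ⟨le_rfl, by lia⟩, rfl⟩)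

theorem finite_range_succPow {x : S} {m n : ℕ} (hmn : m < n)
    (h : succPow x m = succPow x n) : (Set.range (succPow x)).Finite := by
  refine ((Set.finite_Iio n).image (succPow x)).subset ?_
  rintro _ ⟨k, rfl⟩
  induction k using Nat.strong_induction_on with
  | _ k ih =>
    by_cases hk : k < n
    · exact ⟨k, hk, rfl⟩
    · have key := succPow_add_eq_of_eq h (k - n)
      rw [Nat.add_sub_cancel' (not_lt.mp hk)] at key
      rw [← key]
      exact ih _ (by lia)

end SemigroupPowers

section Separability

variable {S T : Type*} [Semigroup S] [Semigroup T]

theorem Separates.of_hom (f : S →ₙ* T) {s : S} {Y : Set S} {Z : Set T}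
    (h : Separates (f s) Z) (hYZ : Set.MapsTo f Y Z) : Separates s Y := by
  obtain ⟨P, _, _, φ, hφ⟩ := h
  exact ⟨P, inferInstance, inferInstance, φ.comp f,
    fun ⟨y, hy, hys⟩ => hφ ⟨f y, hYZ hy, hys⟩⟩

theorem Separates.union_s13 {s : S} {Y Z : Set S} (hY : Separates s Y) (hZ : Separates s Z) :
    Separates s (Y ∪ Z) := by
  obtain ⟨P, _, _, φ, hφ⟩ := hY
  obtain ⟨Q, _, _, ψ, hψ⟩ := hZ
  refine ⟨P × Q, inferInstance, inferInstance, φ.prod ψ, ?_⟩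
  rintro ⟨y, hy | hy, hys⟩
  · exact hφ ⟨y, hy, congrArg Prod.fst hys⟩
  · exact hψ ⟨y, hy, congrArg Prod.snd hys⟩

theorem ResiduallyFinite.separates_singleton (hS : ResiduallyFinite S) {s t : S} (h : s ≠ t) :
    Separates s {t} := by
  obtain ⟨P, _, _, φ, hφ⟩ := hS s t h
  exact ⟨P, inferInstance, inferInstance, φ, fun ⟨_, hy, hys⟩ => hφ (by rw [← hys, hy])⟩

theorem ResiduallyFinite.separates_of_finite (hS : ResiduallyFinite S) {s : S} {Y : Set S}
    (hY : Y.Finite) (hs : s ∉ Y) : Separates s Y := by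
  induction Y, hY using Set.Finite.induction_on with
  | empty => exact ⟨Unit, inferInstance, inferInstance, ⟨fun _ => (), fun _ _ => rfl⟩, by simp⟩
  | @insert y Y _ _ ih =>
    rw [Set.mem_insert_iff, not_or] at hs
    exact (hS.separates_singleton hs.1).union_s13 (ih hs.2)

theorem ResiduallyFinite.prod (hS : ResiduallyFinite S) (hT : ResiduallyFinite T) :
    ResiduallyFinite (S × T) := by
  rintro ⟨s, t⟩ ⟨s', t'⟩ h
  by_cases hs : s = s'
  · have ht : t ≠ t' := fun ht => h (by rw [hs, ht])
    obtain ⟨P, _, _, φ, hφ⟩ := hT t t' ht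
    exact ⟨P, inferInstance, inferInstance, φ.comp (MulHom.snd S T), hφ⟩
  · obtain ⟨P, _, _, φ, hφ⟩ := hS s s' hs
    exact ⟨P, inferInstance, inferInstance, φ.comp (MulHom.fst S T), hφ⟩

theorem IsWSS.isMSS (hS : IsWSS S) : IsMSS S := by
  intro s x h
  simpa using hS s {x} (by simpa using h)

theorem IsMSS.residuallyFinite (hS : IsMSS S) : ResiduallyFinite S := by
  have key : ∀ s t : S, s ∉ Subsemigroup.closure {t} →
      ∃ (P : Type) (_ : Semigroup P) (_ : Finite P) (φ : S →ₙ* P), φ s ≠ φ t := by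
    intro s t h
    obtain ⟨P, _, _, φ, hφ⟩ := hS s t h
    exact ⟨P, inferInstance, inferInstance, φ,
      fun e => hφ ⟨t, Subsemigroup.subset_closure rfl, e.symm⟩⟩
  intro s t hst
  by_cases h₁ : s ∈ Subsemigroup.closure {t}
  swap
  · exact key s t h₁
  by_cases h₂ : t ∈ Subsemigroup.closure {s}
  swap
  · obtain ⟨P, _, _, φ, hφ⟩ := key t s h₂
    exact ⟨P, inferInstance, inferInstance, φ, hφ.symm⟩
  obtain ⟨i, hi⟩ := mem_closure_singleton_iff_exists_succPow.mp h₁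
  obtain ⟨j, rfl⟩ := mem_closure_singleton_iff_exists_succPow.mp h₂
  -- Now `s` generates a finite cyclic group with identity `succPow s k`.
  obtain ⟨j, rfl⟩ : ∃ l, j = l + 1 :=
    Nat.exists_eq_succ_of_ne_zero (by rintro rfl; exact hst rfl)
  rw [succPow_succPow] at hi
  obtain ⟨k, hk⟩ : ∃ k, (j + 1 + 1) * i + (j + 1) = k + 1 := ⟨_, (add_assoc _ _ _).symm⟩
  rw [hk] at hi
  have shift (l : ℕ) : succPow s (k + 1 + l) = succPow s l := by
    simpa using succPow_add_eq_of_eq (m := k + 1) (n := 0) hi l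
  have hidem (n : ℕ) : succPow (succPow s k) n = succPow s k := by
    induction n with
    | zero => rfl
    | succ n ih =>
      rw [succPow, ih, succPow_mul_succPow, show k + k + 1 = k + 1 + k by ring, shift]
  have hne : succPow s j ∉ Subsemigroup.closure {succPow s k} := by
    rw [mem_closure_singleton_iff_exists_succPow]
    rintro ⟨n, hn⟩
    rw [hidem] at hn
    apply hst
    rw [succPow, ← hn]
    exact hi.symm
  obtain ⟨P, _, _, φ, hφ⟩ := key _ _ hne
  refine ⟨P, inferInstance, inferInstance, φ, fun e => hφ ?_⟩
  rw [map_succPow] at e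
  have h := succPow_add_eq_of_eq (x := φ s) (m := 0) (n := j + 1) e k
  rw [zero_add, ← map_succPow, ← map_succPow, show j + 1 + k = k + 1 + j by ring, shift] at h
  exact h.symm

theorem IsWSS.exists_hom_isolating_succPow (hS : IsWSS S) {x : S} {m : ℕ}
    (h : ∀ n, m < n → succPow x n ≠ succPow x m) :
    ∃ (P : Type) (_ : Semigroup P) (_ : Finite P) (φ : S →ₙ* P),
      ∀ n, φ (succPow x n) = φ (succPow x m) → n = m := by
  classical
  have hcoe : (((Finset.Icc (m + 1) (2 * m + 2)).image (succPow x) : Finset S) : Set S) =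
      succPow x '' Set.Icc (m + 1) (2 * m + 2) := by simp
  have hsep := hS (succPow x m) ((Finset.Icc (m + 1) (2 * m + 2)).image (succPow x))
  rw [hcoe, mem_closure_succPow_Icc_iff] at hsep
  obtain ⟨P, _, _, φ, hφ⟩ := hsep (fun ⟨n, hn, e⟩ => h n hn e)
  have hgt : ∀ n, m < n → φ (succPow x n) ≠ φ (succPow x m) := fun n hn e =>
    hφ ⟨_, mem_closure_succPow_Icc_iff.mpr ⟨n, hn, rfl⟩, e⟩
  refine ⟨P, inferInstance, inferInstance, φ, fun n e => ?_⟩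
  rcases lt_trichotomy n m with hn | hn | hn
  · rw [map_succPow, map_succPow] at e
    have e' := succPow_add_eq_of_eq e (m - n)
    rw [Nat.add_sub_cancel' hn.le] at e'
    rw [← map_succPow, ← map_succPow] at e'
    exact (hgt _ (by lia) e'.symm).elim
  · exact hn
  · exact (hgt n hn e).elim

theorem IsWSS.separates_prod_of_isolated (hS : IsWSS S) (hT : ResiduallyFinite T)
    {x : S} {t y : T} {m : ℕ} (h : ∀ n, m < n → succPow x n ≠ succPow x m)
    (hst : (succPow x m, t) ∉ Subsemigroup.closure {(x, y)}) :
    Separates (succPow x m, t) (Subsemigroup.closure {(x, y)} : Set (S × T)) := by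
  obtain ⟨P, _, _, φ, hφ⟩ := hS.exists_hom_isolating_succPow h
  have ht : succPow y m ≠ t := by
    rintro rfl
    exact hst (mem_closure_singleton_iff_exists_succPow.mpr ⟨m, succPow_prod x y m⟩)
  obtain ⟨Q, _, _, ψ, hψ⟩ := hT _ _ ht
  refine ⟨P × Q, inferInstance, inferInstance, φ.prodMap ψ, ?_⟩
  rintro ⟨_, hz, e⟩
  obtain ⟨n, rfl⟩ := mem_closure_singleton_iff_exists_succPow.mp hz
  rw [succPow_prod] at e
  obtain rfl := hφ n (congrArg Prod.fst e)
  exact hψ (congrArg Prod.snd e)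

end Separability

/-- The direct product of two weakly subsemigroup separable semigroups is
monogenic subsemigroup separable. -/
theorem stmt_13 (S T : Type*) [Semigroup S] [Semigroup T]
    (hS : IsWSS S) (hT : IsWSS T) : IsMSS (S × T) := by
  rintro ⟨s, t⟩ ⟨x, y⟩ h
  have hSf := hS.isMSS.residuallyFinite
  have hTf := hT.isMSS.residuallyFinite
  by_cases hs : s ∈ Subsemigroup.closure {x}
  swap
  · refine Separates.of_hom (MulHom.fst S T) (hS.isMSS s x hs) fun z hz => ?_
    obtain ⟨n, rfl⟩ := mem_closure_singleton_iff_exists_succPow.mp hz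
    exact mem_closure_singleton_iff_exists_succPow.mpr ⟨n, by rw [succPow_prod]; rfl⟩
  by_cases ht : t ∈ Subsemigroup.closure {y}
  swap
  · refine Separates.of_hom (MulHom.snd S T) (hT.isMSS t y ht) fun z hz => ?_
    obtain ⟨n, rfl⟩ := mem_closure_singleton_iff_exists_succPow.mp hz
    exact mem_closure_singleton_iff_exists_succPow.mpr ⟨n, by rw [succPow_prod]; rfl⟩
  obtain ⟨a, rfl⟩ := mem_closure_singleton_iff_exists_succPow.mp hs
  obtain ⟨b, rfl⟩ := mem_closure_singleton_iff_exists_succPow.mp ht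
  by_cases ha : ∀ n, a < n → succPow x n ≠ succPow x a
  · exact hS.separates_prod_of_isolated hTf ha h
  by_cases hb : ∀ n, b < n → succPow y n ≠ succPow y b
  · let swap : S × T →ₙ* T × S := (MulHom.snd S T).prod (MulHom.fst S T)
    refine Separates.of_hom swap (hT.separates_prod_of_isolated hSf hb (y := x) ?_) fun z hz => ?_
    · intro h'
      obtain ⟨n, hn⟩ := mem_closure_singleton_iff_exists_succPow.mp h'
      rw [succPow_prod] at hn
      refine h (mem_closure_singleton_iff_exists_succPow.mpr ⟨n, ?_⟩)
      rw [succPow_prod]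
      exact congrArg Prod.swap hn
    · obtain ⟨n, rfl⟩ := mem_closure_singleton_iff_exists_succPow.mp hz
      exact mem_closure_singleton_iff_exists_succPow.mpr
        ⟨n, by rw [succPow_prod, succPow_prod]; rfl⟩
  push Not at ha hb
  obtain ⟨m, hm, hxm⟩ := ha
  obtain ⟨n, hn, hyn⟩ := hb
  refine (hSf.prod hTf).separates_of_finite (((finite_range_succPow hm hxm.symm).prod
    (finite_range_succPow hn hyn.symm)).subset fun z hz => ?_) h
  obtain ⟨k, rfl⟩ := mem_closure_singleton_iff_exists_succPow.mp hz
  rw [succPow_prod]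
  exact ⟨⟨k, rfl⟩, ⟨k, rfl⟩⟩
end
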